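/- Let h₂(u,v) denote the second coordinate of the evolutoid E₁(u,v). Then h₂(0,0) = 0, ∂_u h₂(0,0) = ∂_v h₂(0,0) = 0, ∂²_u h₂(0,0) = −a₂₁/κ₂, ∂_u∂_v h₂(0,0) = 0, and ∂²_v h₂(0,0) = a₀₃/κ₂. -/

import Mathlib

noncomputable section

open Real

def dot3 (a b : Fin 3 → ℝ) : ℝ := a 0 * b 0 + a 1 * b 1 + a 2 * b 2

def cross3 (a b : Fin 3 → ℝ) : Fin 3 → ℝ :=
  ![a 1 * b 2 - a 2 * b 1, a 2 * b 0 - a 0 * b 2, a 0 * b 1 - a 1 * b 0]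

def norm3 (a : Fin 3 → ℝ) : ℝ := Real.sqrt (dot3 a a)

noncomputable def pdu {X : Type*} [NormedAddCommGroup X] [NormedSpace ℝ X]
    (f : ℝ × ℝ → X) : ℝ × ℝ → X := fun p => deriv (fun t => f (t, p.2)) p.1

noncomputable def pdv {X : Type*} [NormedAddCommGroup X] [NormedSpace ℝ X]
    (f : ℝ × ℝ → X) : ℝ × ℝ → X := fun p => deriv (fun t => f (p.1, t)) p.2

noncomputable def pd (i j : ℕ) (f : ℝ × ℝ → ℝ) : ℝ × ℝ → ℝ :=
  (pdu (X := ℝ))^[i] ((pdv (X := ℝ))^[j] f)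

def mongeSurf (f : ℝ × ℝ → ℝ) : ℝ × ℝ → Fin 3 → ℝ := fun p => ![p.1, p.2, f p]

noncomputable def unitNormal (ψ : ℝ × ℝ → Fin 3 → ℝ) : ℝ × ℝ → Fin 3 → ℝ := fun p =>
  (norm3 (cross3 (pdu ψ p) (pdv ψ p)))⁻¹ • cross3 (pdu ψ p) (pdv ψ p)

noncomputable def coefE (f : ℝ × ℝ → ℝ) : ℝ × ℝ → ℝ := fun p => 1 + (pdu f p) ^ 2
noncomputable def coefG (f : ℝ × ℝ → ℝ) : ℝ × ℝ → ℝ := fun p => 1 + (pdv f p) ^ 2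

noncomputable def kap2 (f : ℝ × ℝ → ℝ) : ℝ × ℝ → ℝ := fun p =>
  dot3 (pdv (pdv (mongeSurf f)) p) (unitNormal (mongeSurf f) p) / coefG f p

noncomputable def rfun (α : ℝ) (f : ℝ × ℝ → ℝ) : ℝ × ℝ → ℝ := fun p =>
  -(2 * Real.sqrt (coefE f p) * coefG f p) /
    (Real.cos α * pdu (coefG f) p -
      2 * Real.sin α * Real.sqrt (coefE f p) * coefG f p * kap2 f p)

noncomputable def evolutoid (α : ℝ) (f : ℝ × ℝ → ℝ) : ℝ × ℝ → Fin 3 → ℝ := fun p =>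
  mongeSurf f p +
    rfun α f p •
      ((Real.cos α / Real.sqrt (coefE f p)) • pdu (mongeSurf f) p +
        Real.sin α • unitNormal (mongeSurf f) p)

def MongeHyp (κ₁ κ₂ : ℝ) (a : ℕ → ℕ → ℝ) (f : ℝ × ℝ → ℝ) : Prop :=
  ContDiff ℝ (⊤ : ℕ∞) f ∧ f (0, 0) = 0 ∧
    pdu f (0, 0) = 0 ∧ pdv f (0, 0) = 0 ∧
    pd 2 0 f (0, 0) = κ₁ ∧ pd 1 1 f (0, 0) = 0 ∧ pd 0 2 f (0, 0) = κ₂ ∧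
    ∀ i j : ℕ, 3 ≤ i + j → i + j ≤ 4 → pd i j f (0, 0) = a i j

noncomputable def gaussK (ψ : ℝ × ℝ → Fin 3 → ℝ) : ℝ × ℝ → ℝ := fun p =>
  (dot3 (pdu (pdu ψ) p) (unitNormal ψ p) * dot3 (pdv (pdv ψ) p) (unitNormal ψ p) -
      dot3 (pdu (pdv ψ) p) (unitNormal ψ p) ^ 2) /
    (norm3 (pdu ψ p) ^ 2 * norm3 (pdv ψ p) ^ 2 - (dot3 (pdu ψ p) (pdv ψ p)) ^ 2)

def AEquivalentAt {E F : Type*} [NormedAddCommGroup E] [NormedSpace ℝ E]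
    [NormedAddCommGroup F] [NormedSpace ℝ F]
    (f : E → F) (p : E) (g : E → F) (q : E) : Prop :=
  ∃ (h : PartialHomeomorph E E) (ξ : PartialHomeomorph F F),
    p ∈ h.source ∧ h p = q ∧
    ContDiffOn ℝ (⊤ : ℕ∞) h h.source ∧ ContDiffOn ℝ (⊤ : ℕ∞) h.symm h.target ∧
    f p ∈ ξ.source ∧ ξ (f p) = g q ∧
    ContDiffOn ℝ (⊤ : ℕ∞) ξ ξ.source ∧ ContDiffOn ℝ (⊤ : ℕ∞) ξ.symm ξ.target ∧
    ∀ᶠ x in nhds p, ξ (f x) = g (h x)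

section PartialDerivatives

variable {X : Type*} [NormedAddCommGroup X] [NormedSpace ℝ X] {F G : ℝ × ℝ → X} {p : ℝ × ℝ}

lemma pdu_eq_fderiv (hF : DifferentiableAt ℝ F p) : pdu F p = fderiv ℝ F p (1, 0) := by
  have h : HasDerivAt (fun t : ℝ => (t, p.2)) ((1 : ℝ), (0 : ℝ)) p.1 :=
    (hasDerivAt_id p.1).prodMk (hasDerivAt_const p.1 p.2)
  exact (HasFDerivAt.comp_hasDerivAt (l := F) p.1 hF.hasFDerivAt h).deriv

lemma pdv_eq_fderiv (hF : DifferentiableAt ℝ F p) : pdv F p = fderiv ℝ F p (0, 1) := by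
  have h : HasDerivAt (fun t : ℝ => (p.1, t)) ((0 : ℝ), (1 : ℝ)) p.2 :=
    (hasDerivAt_const p.2 p.1).prodMk (hasDerivAt_id p.2)
  exact (HasFDerivAt.comp_hasDerivAt (l := F) p.2 hF.hasFDerivAt h).deriv

lemma pdu_congr (h : F =ᶠ[nhds p] G) : pdu F p = pdu G p := by
  have hc : Filter.Tendsto (fun t : ℝ => (t, p.2)) (nhds p.1) (nhds p) :=
    Continuous.tendsto (by fun_prop) p.1
  exact Filter.EventuallyEq.deriv_eq (hc.eventually h)

lemma pdv_congr (h : F =ᶠ[nhds p] G) : pdv F p = pdv G p := by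
  have hc : Filter.Tendsto (fun t : ℝ => (p.1, t)) (nhds p.2) (nhds p) :=
    Continuous.tendsto (by fun_prop) p.2
  exact Filter.EventuallyEq.deriv_eq (hc.eventually h)

end PartialDerivatives

section DirectionalDerivatives

variable {V X : Type*} [NormedAddCommGroup V] [NormedSpace ℝ V]
  [NormedAddCommGroup X] [NormedSpace ℝ X] {x : V}

lemma ContDiffAt.eventually_differentiableAt {F : V → X} (hF : ContDiffAt ℝ 2 F x) :
    ∀ᶠ y in nhds x, DifferentiableAt ℝ F y :=
  (hF.eventually (by simp)).mono fun _ hy => hy.differentiableAt (by norm_num)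

lemma ContDiffAt.differentiableAt_fderiv_apply {F : V → X} (hF : ContDiffAt ℝ 2 F x) (w : V) :
    DifferentiableAt ℝ (fun y => fderiv ℝ F y w) x :=
  ((hF.fderiv_right (m := 1) (by norm_num)).differentiableAt (by norm_num)).clm_apply
    (differentiableAt_const w)

lemma fderiv_fderiv_mul {q M : V → ℝ} (hq : ContDiffAt ℝ 2 q x) (hM : ContDiffAt ℝ 2 M x)
    (w z : V) :
    fderiv ℝ (fun y => fderiv ℝ (fun y => q y * M y) y w) x z =
      q x * fderiv ℝ (fun y => fderiv ℝ M y w) x z + fderiv ℝ q x z * fderiv ℝ M x w +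
        fderiv ℝ q x w * fderiv ℝ M x z + M x * fderiv ℝ (fun y => fderiv ℝ q y w) x z := by
  have hev : (fun y => fderiv ℝ (fun y => q y * M y) y w) =ᶠ[nhds x]
      fun y => q y * fderiv ℝ M y w + M y * fderiv ℝ q y w := by
    filter_upwards [hq.eventually_differentiableAt, hM.eventually_differentiableAt] with y h₁ h₂
    rw [fderiv_fun_mul h₁ h₂]
    simp
  have hqd := hq.differentiableAt (by norm_num)
  have hMd := hM.differentiableAt (by norm_num)
  rw [hev.fderiv_eq, fderiv_fun_add (hqd.fun_mul (hM.differentiableAt_fderiv_apply w))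
    (hMd.fun_mul (hq.differentiableAt_fderiv_apply w)),
    fderiv_fun_mul hqd (hM.differentiableAt_fderiv_apply w),
    fderiv_fun_mul hMd (hq.differentiableAt_fderiv_apply w)]
  simp
  ring

lemma fderiv_fderiv_clm_sub (L : V →L[ℝ] X) {F : V → X} (hF : ContDiffAt ℝ 2 F x) (w z : V) :
    fderiv ℝ (fun y => fderiv ℝ (fun y => L y - F y) y w) x z =
      -fderiv ℝ (fun y => fderiv ℝ F y w) x z := by
  have hev : (fun y => fderiv ℝ (fun y => L y - F y) y w) =ᶠ[nhds x]
      fun y => L w - fderiv ℝ F y w := by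
    filter_upwards [hF.eventually_differentiableAt] with y hy
    rw [fderiv_fun_sub L.differentiableAt hy]
    simp
  rw [hev.fderiv_eq, fderiv_const_sub]
  simp

end DirectionalDerivatives

section SecondOrder

variable {F : ℝ × ℝ → ℝ} {p : ℝ × ℝ}

lemma pdu_pdu_eq_fderiv (hF : ContDiffAt ℝ 2 F p) :
    pdu (pdu F) p = fderiv ℝ (fun y => fderiv ℝ F y (1, 0)) p (1, 0) := by
  rw [pdu_congr (hF.eventually_differentiableAt.mono fun _ hy => pdu_eq_fderiv hy),
    pdu_eq_fderiv (hF.differentiableAt_fderiv_apply _)]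

lemma pdu_pdv_eq_fderiv (hF : ContDiffAt ℝ 2 F p) :
    pdu (pdv F) p = fderiv ℝ (fun y => fderiv ℝ F y (0, 1)) p (1, 0) := by
  rw [pdu_congr (hF.eventually_differentiableAt.mono fun _ hy => pdv_eq_fderiv hy),
    pdu_eq_fderiv (hF.differentiableAt_fderiv_apply _)]

lemma pdv_pdv_eq_fderiv (hF : ContDiffAt ℝ 2 F p) :
    pdv (pdv F) p = fderiv ℝ (fun y => fderiv ℝ F y (0, 1)) p (0, 1) := by
  rw [pdv_congr (hF.eventually_differentiableAt.mono fun _ hy => pdv_eq_fderiv hy),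
    pdv_eq_fderiv (hF.differentiableAt_fderiv_apply _)]

lemma ContDiff.pdu (hF : ContDiff ℝ (⊤ : ℕ∞) F) : ContDiff ℝ (⊤ : ℕ∞) (pdu F) := by
  have h : _root_.pdu F = fun y => fderiv ℝ F y (1, 0) :=
    funext fun _ => pdu_eq_fderiv (hF.differentiable (by simp) _)
  rw [h]
  exact (hF.fderiv_right (by simp)).clm_apply contDiff_const

lemma ContDiff.pdv (hF : ContDiff ℝ (⊤ : ℕ∞) F) : ContDiff ℝ (⊤ : ℕ∞) (pdv F) := by
  have h : _root_.pdv F = fun y => fderiv ℝ F y (0, 1) :=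
    funext fun _ => pdv_eq_fderiv (hF.differentiable (by simp) _)
  rw [h]
  exact (hF.fderiv_right (by simp)).clm_apply contDiff_const

end SecondOrder

section MongeForm

variable {f : ℝ × ℝ → ℝ}

lemma pdu_mongeSurf (hf : Differentiable ℝ f) (p : ℝ × ℝ) :
    pdu (mongeSurf f) p = ![1, 0, pdu f p] := by
  refine HasDerivAt.deriv (hasDerivAt_pi.2 fun i => ?_)
  have hd : DifferentiableAt ℝ (fun t : ℝ => f (t, p.2)) p.1 := by fun_prop
  fin_cases i
  · exact hasDerivAt_id p.1
  · exact hasDerivAt_const p.1 p.2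
  · exact hd.hasDerivAt

lemma pdv_mongeSurf (hf : Differentiable ℝ f) (p : ℝ × ℝ) :
    pdv (mongeSurf f) p = ![0, 1, pdv f p] := by
  refine HasDerivAt.deriv (hasDerivAt_pi.2 fun i => ?_)
  have hd : DifferentiableAt ℝ (fun t : ℝ => f (p.1, t)) p.2 := by fun_prop
  fin_cases i
  · exact hasDerivAt_const p.2 p.1
  · exact hasDerivAt_id p.2
  · exact hd.hasDerivAt

lemma pdv_pdv_mongeSurf (hf : Differentiable ℝ f) (hf' : Differentiable ℝ (pdv f)) (p : ℝ × ℝ) :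
    pdv (pdv (mongeSurf f)) p = ![0, 0, pdv (pdv f) p] := by
  rw [funext (pdv_mongeSurf hf)]
  refine HasDerivAt.deriv (hasDerivAt_pi.2 fun i => ?_)
  have hd : DifferentiableAt ℝ (fun t : ℝ => pdv f (p.1, t)) p.2 := by fun_prop
  fin_cases i
  · exact hasDerivAt_const p.2 (0 : ℝ)
  · exact hasDerivAt_const p.2 (1 : ℝ)
  · exact hd.hasDerivAt

lemma pdu_coefG (hf' : Differentiable ℝ (pdv f)) (p : ℝ × ℝ) :
    pdu (coefG f) p = 2 * pdv f p * pdu (pdv f) p := by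
  have hd : DifferentiableAt ℝ (fun t : ℝ => pdv f (t, p.2)) p.1 := by fun_prop
  have h := (hd.hasDerivAt.pow 2).const_add 1
  refine h.deriv.trans ?_
  simp [pdu]

lemma unitNormal_mongeSurf (hf : Differentiable ℝ f) (p : ℝ × ℝ) :
    unitNormal (mongeSurf f) p =
      (√(1 + pdu f p ^ 2 + pdv f p ^ 2))⁻¹ • ![-pdu f p, -pdv f p, 1] := by
  have hc : cross3 ![1, 0, pdu f p] ![0, 1, pdv f p] = ![-pdu f p, -pdv f p, 1] := by
    simp [cross3]
  rw [unitNormal, pdu_mongeSurf hf, pdv_mongeSurf hf, hc, norm3, dot3]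
  congr 3
  simp
  ring

/-- The function `M` for which the evolutoid of `f` has second coordinate `v - f_v * M`. -/
def evolutoidFactor (α : ℝ) (f : ℝ × ℝ → ℝ) : ℝ × ℝ → ℝ := fun p =>
  sin α * √(1 + pdu f p ^ 2) * (1 + pdv f p ^ 2) /
    (sin α * √(1 + pdu f p ^ 2) * pdv (pdv f) p -
      cos α * √(1 + pdu f p ^ 2 + pdv f p ^ 2) * (pdv f p * pdu (pdv f) p))

lemma evolutoid_apply_one (α : ℝ) (hf : Differentiable ℝ f) (hf' : Differentiable ℝ (pdv f))
    (p : ℝ × ℝ) : evolutoid α f p 1 = p.2 - pdv f p * evolutoidFactor α f p := by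
  have hE : 0 < √(1 + pdu f p ^ 2) := by positivity
  have hW : 0 < √(1 + pdu f p ^ 2 + pdv f p ^ 2) := by positivity
  have hG : 0 < 1 + pdv f p ^ 2 := by positivity
  simp only [evolutoid, rfun, kap2, evolutoidFactor, pdu_mongeSurf hf, pdv_pdv_mongeSurf hf hf',
    unitNormal_mongeSurf hf, pdu_coefG hf', coefE, coefG, mongeSurf, dot3]
  simp only [Pi.add_apply, Pi.smul_apply, smul_eq_mul, Matrix.cons_val_zero, Matrix.cons_val_one,
    Matrix.cons_val, mul_zero, zero_mul, zero_add, mul_one]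
  generalize √(1 + pdu f p ^ 2) = S at *
  generalize √(1 + pdu f p ^ 2 + pdv f p ^ 2) = W at *
  generalize 1 + pdv f p ^ 2 = G at *
  generalize pdv (pdv f) p = t
  generalize pdu (pdv f) p = m
  generalize pdv f p = q
  have hD : cos α * (2 * q * m) - 2 * sin α * S * G * (t * W⁻¹ / G) =
      -(2 / W) * (sin α * S * t - cos α * W * (q * m)) := by
    field_simp
    ring
  rw [hD]
  rcases eq_or_ne (sin α * S * t - cos α * W * (q * m)) 0 with h0 | h0
  · simp [h0]
  · field_simp
    ring

lemma contDiffAt_evolutoidFactor {α : ℝ} {p : ℝ × ℝ} (hf : ContDiff ℝ (⊤ : ℕ∞) f)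
    (hα : sin α ≠ 0) (hv : pdv f p = 0) (hvv : pdv (pdv f) p ≠ 0) :
    ContDiffAt ℝ 2 (evolutoidFactor α f) p := by
  have hle : (2 : WithTop ℕ∞) ≤ ((⊤ : ℕ∞) : WithTop ℕ∞) :=
    WithTop.coe_le_coe.2 (le_top : (2 : ℕ∞) ≤ ⊤)
  have h₁ : ContDiffAt ℝ 2 (pdu f) p := (hf.pdu.of_le hle).contDiffAt
  have h₂ : ContDiffAt ℝ 2 (pdv f) p := (hf.pdv.of_le hle).contDiffAt
  have h₃ : ContDiffAt ℝ 2 (pdv (pdv f)) p := (hf.pdv.pdv.of_le hle).contDiffAt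
  have h₄ : ContDiffAt ℝ 2 (pdu (pdv f)) p := (hf.pdv.pdu.of_le hle).contDiffAt
  have hS : ContDiffAt ℝ 2 (fun p => √(1 + pdu f p ^ 2)) p :=
    (contDiffAt_const.add (h₁.pow 2)).sqrt (by positivity)
  have hW : ContDiffAt ℝ 2 (fun p => √(1 + pdu f p ^ 2 + pdv f p ^ 2)) p :=
    ((contDiffAt_const.add (h₁.pow 2)).add (h₂.pow 2)).sqrt (by positivity)
  have hE : √(1 + pdu f p ^ 2) ≠ 0 := by positivity
  refine ((contDiffAt_const.mul hS).mul (contDiffAt_const.add (h₂.pow 2))).div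
    (((contDiffAt_const.mul hS).mul h₃).sub ((contDiffAt_const.mul hW).mul (h₂.mul h₄))) ?_
  simp [hv, hvv, hα, hE]

lemma fderiv_evolutoidFactor {α : ℝ} {p : ℝ × ℝ} (hf : ContDiff ℝ (⊤ : ℕ∞) f)
    (hα : sin α ≠ 0) (hu : pdu f p = 0) (hv : pdv f p = 0) (huv : pdu (pdv f) p = 0)
    (hvv : pdv (pdv f) p ≠ 0) (w : ℝ × ℝ) :
    fderiv ℝ (evolutoidFactor α f) p w =
      -fderiv ℝ (pdv (pdv f)) p w / pdv (pdv f) p ^ 2 := by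
  have h₁ := (hf.pdu.differentiable (by simp) p).hasFDerivAt
  have h₂ := (hf.pdv.differentiable (by simp) p).hasFDerivAt
  have h₃ := (hf.pdv.pdv.differentiable (by simp) p).hasFDerivAt
  have h₄ := (hf.pdv.pdu.differentiable (by simp) p).hasFDerivAt
  have hM := ((contDiffAt_evolutoidFactor hf hα hv hvv).differentiableAt
    (by norm_num)).hasFDerivAt
  have hS := ((h₁.pow 2).const_add 1).sqrt (by positivity)
  have hW := (((h₁.pow 2).const_add 1).fun_add (h₂.pow 2)).sqrt (by positivity)
  have hA := (hS.const_mul (sin α)).fun_mul ((h₂.pow 2).const_add 1)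
  have hD := ((hS.const_mul (sin α)).fun_mul h₃).fun_sub
    ((hW.const_mul (cos α)).fun_mul (h₂.fun_mul h₄))
  have hD0 : sin α * √(1 + pdu f p ^ 2) * pdv (pdv f) p -
      cos α * √(1 + pdu f p ^ 2 + pdv f p ^ 2) * (pdv f p * pdu (pdv f) p) ≠ 0 := by
    simp [hu, hv, hvv, hα]
  have hMD := (hM.fun_mul hD).congr_of_eventuallyEq
    ((hD.continuousAt.eventually_ne hD0).mono fun y hy => (div_mul_cancel₀ _ hy).symm)
  have h := congrArg (fun T : ℝ × ℝ →L[ℝ] ℝ => T w) (hMD.unique hA)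
  simp [hu, hv, huv, evolutoidFactor] at h
  field_simp at h ⊢
  exact mul_left_cancel₀ hα (by linear_combination h)

end MongeForm

theorem evolutoid_second_coordinate_jet
    (α κ₁ κ₂ : ℝ) (a : ℕ → ℕ → ℝ) (f : ℝ × ℝ → ℝ)
    (hα : α ∈ Set.Ioo 0 (Real.pi / 2))
    (hκ : κ₂ < κ₁) (hκ₁ : κ₁ ≠ 0) (hκ₂ : κ₂ ≠ 0)
    (hf : MongeHyp κ₁ κ₂ a f)
    (h₂ : ℝ × ℝ → ℝ) (hh₂ : h₂ = fun p => evolutoid α f p 1) :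
    h₂ (0, 0) = 0 ∧ pdu h₂ (0, 0) = 0 ∧ pdv h₂ (0, 0) = 0 ∧
    pdu (pdu h₂) (0, 0) = -(a 2 1) / κ₂ ∧
    pdu (pdv h₂) (0, 0) = 0 ∧
    pdv (pdv h₂) (0, 0) = a 0 3 / κ₂ := by
  obtain ⟨hsm, -, hu, hv, -, huv, hvv, ha⟩ := hf
  replace huv : pdu (pdv f) (0, 0) = 0 := huv
  replace hvv : pdv (pdv f) (0, 0) = κ₂ := hvv
  have h21 : pdu (pdu (pdv f)) (0, 0) = a 2 1 := ha 2 1 (by norm_num) (by norm_num)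
  have h12 : pdu (pdv (pdv f)) (0, 0) = a 1 2 := ha 1 2 (by norm_num) (by norm_num)
  have h03 : pdv (pdv (pdv f)) (0, 0) = a 0 3 := ha 0 3 (by norm_num) (by norm_num)
  have hs : sin α ≠ 0 := (sin_pos_of_pos_of_lt_pi hα.1 (by linarith [hα.2, pi_pos])).ne'
  have hle : (2 : WithTop ℕ∞) ≤ ((⊤ : ℕ∞) : WithTop ℕ∞) :=
    WithTop.coe_le_coe.2 (le_top : (2 : ℕ∞) ≤ ⊤)
  have hne : pdv (pdv f) (0, 0) ≠ 0 := hvv ▸ hκ₂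
  have hq : ContDiffAt ℝ 2 (pdv f) (0, 0) := (hsm.pdv.of_le hle).contDiffAt
  have hM := contDiffAt_evolutoidFactor hsm hs hv hne
  have hqd := hq.differentiableAt (by norm_num)
  have hMd := hM.differentiableAt (by norm_num)
  have htd : DifferentiableAt ℝ (pdv (pdv f)) (0, 0) := hsm.pdv.pdv.differentiable (by simp) _
  have hM0 : evolutoidFactor α f (0, 0) = 1 / κ₂ := by
    simp [evolutoidFactor, hu, hv, hvv]
    field_simp
  have hM' := fderiv_evolutoidFactor hsm hs hu hv huv hne
  let L : ℝ × ℝ →L[ℝ] ℝ := ContinuousLinearMap.snd ℝ ℝ ℝ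
  have hh : h₂ = fun p => L p - pdv f p * evolutoidFactor α f p := by
    rw [hh₂]
    exact funext fun p => evolutoid_apply_one α (hsm.differentiable (by simp))
      (hsm.pdv.differentiable (by simp)) p
  have hprod : ContDiffAt ℝ 2 (fun p => pdv f p * evolutoidFactor α f p) (0, 0) := hq.mul hM
  have hh2 : ContDiffAt ℝ 2 h₂ (0, 0) := hh ▸ L.contDiff.contDiffAt.sub hprod
  have hh1 := hh2.differentiableAt (by norm_num)
  have hd (w : ℝ × ℝ) : fderiv ℝ h₂ (0, 0) w = w.2 - fderiv ℝ (pdv f) (0, 0) w / κ₂ := by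
    rw [hh, fderiv_fun_sub L.differentiableAt (hqd.fun_mul hMd), fderiv_fun_mul hqd hMd, L.fderiv]
    simp [L, hv, hM0]
    ring
  have hdd (w z : ℝ × ℝ) : fderiv ℝ (fun y => fderiv ℝ h₂ y w) (0, 0) z =
      (fderiv ℝ (pdv f) (0, 0) z * fderiv ℝ (pdv (pdv f)) (0, 0) w +
        fderiv ℝ (pdv f) (0, 0) w * fderiv ℝ (pdv (pdv f)) (0, 0) z) / κ₂ ^ 2 -
      fderiv ℝ (fun y => fderiv ℝ (pdv f) y w) (0, 0) z / κ₂ := by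
    rw [hh, fderiv_fderiv_clm_sub L hprod, fderiv_fderiv_mul hq hM, hM', hM', hM0, hv, hvv]
    ring
  rw [pdu_eq_fderiv hqd] at huv
  have hqv := hvv
  rw [pdv_eq_fderiv hqd] at hqv
  rw [pdu_pdu_eq_fderiv hq] at h21
  have h12' := h12
  have h03' := h03
  rw [pdu_pdv_eq_fderiv hq] at h12'
  rw [pdv_pdv_eq_fderiv hq] at h03'
  rw [pdu_eq_fderiv htd] at h12
  rw [pdv_eq_fderiv htd] at h03
  refine ⟨?_, ?_, ?_, ?_, ?_, ?_⟩
  · simp [hh, L, hv]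
  · rw [pdu_eq_fderiv hh1, hd, huv]
    simp
  · rw [pdv_eq_fderiv hh1, hd, hqv, div_self hκ₂, sub_self]
  · rw [pdu_pdu_eq_fderiv hh2, hdd, huv, h21]
    ring
  · rw [pdu_pdv_eq_fderiv hh2, hdd, huv, hqv, h12, h12']
    field_simp
    ring
  · rw [pdv_pdv_eq_fderiv hh2, hdd, hqv, h03, h03']
    field_simp
    ring
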